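/- arXiv:2205.07200 — 5 statements merged into one kernel-verified Lean document; each statement's English description precedes it below -/
import Mathlib

section
/- Let A = diag(a₁,…,aₙ) be a real diagonal n×n matrix and let w ∈ C²(ℝⁿ) be a generalized symmetric function with respect to A, i.e. w(x) = f(s) with s = ½xᵀAx for a C² function f. Then for every 1 ≤ k ≤ n and every x ∈ ℝⁿ, σ_k(λ(D²w(x))) = σ_k(λ(A))(f'(s))^k + f''(s)(f'(s))^{k−1} Σ_{i=1}^n σ_{k−1;i}(λ(A))(a_i x_i)², where s = ½xᵀAx. -/
open scoped BigOperators
open Filter MeasureTheory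

noncomputable section

/-- The `j`-th elementary symmetric function of `lam ∈ ℝⁿ`. -/
def esym (n j : ℕ) (lam : Fin n → ℝ) : ℝ :=
  ∑ S ∈ Finset.powersetCard j (Finset.univ : Finset (Fin n)), ∏ i ∈ S, lam i

/-- `σ_{j;i}`: the `j`-th elementary symmetric function with the `i`-th variable set to `0`. -/
def esymRem (n j : ℕ) (lam : Fin n → ℝ) (i : Fin n) : ℝ :=
  esym n j (Function.update lam i 0)

/-- The increasingly ordered eigenvalue vector of a real symmetric matrix
(junk value `0` if the matrix is not symmetric). -/
def eigs {n : ℕ} (M : Matrix (Fin n) (Fin n) ℝ) : Fin n → ℝ :=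
  if h : M.IsHermitian then h.eigenvalues ∘ (Tuple.sort h.eigenvalues) else 0

/-- The Hessian matrix `D²u(x)` of `u : ℝⁿ → ℝ`. -/
def hessianMatrix {n : ℕ} (u : EuclideanSpace ℝ (Fin n) → ℝ) (x : EuclideanSpace ℝ (Fin n)) :
    Matrix (Fin n) (Fin n) ℝ :=
  fun i j =>
    fderiv ℝ (fun y => fderiv ℝ u y (EuclideanSpace.single j 1)) x (EuclideanSpace.single i 1)

/-- The quadratic form `½ xᵀ A x`. -/
def quadForm {n : ℕ} (A : Matrix (Fin n) (Fin n) ℝ) (x : EuclideanSpace ℝ (Fin n)) : ℝ :=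
  (1 / 2) * ∑ i, ∑ j, A i j * x i * x j

/-- The Gårding cone `Γ_k = {λ : σ_j(λ) > 0, 1 ≤ j ≤ k}`. -/
def GammaK (n k : ℕ) : Set (Fin n → ℝ) :=
  {lam | ∀ j, 1 ≤ j → j ≤ k → 0 < esym n j lam}

/-- The Hessian quotient operator `S_{k,l}(M) = σ_k(λ(M))/σ_l(λ(M))`. -/
def Skl (n k l : ℕ) (M : Matrix (Fin n) (Fin n) ℝ) : ℝ :=
  esym n k (eigs M) / esym n l (eigs M)

/-- `H_k(A) = max_i σ_{k-1;i}(λ(A)) λ_i(A) / σ_k(λ(A))`. -/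
def Hk (n k : ℕ) (A : Matrix (Fin n) (Fin n) ℝ) : ℝ :=
  ⨆ i : Fin n, esymRem n (k - 1) (eigs A) i * eigs A i / esym n k (eigs A)

/-- `ψ` is admissible on the open set `A` with respect to the cone `Γ`:
it is `C²` on `A` and `λ(D²ψ) ∈ Γ` there. -/
def Admissible {n : ℕ} (Γ : Set (Fin n → ℝ)) (A : Set (EuclideanSpace ℝ (Fin n)))
    (ψ : EuclideanSpace ℝ (Fin n) → ℝ) : Prop :=
  ContDiffOn ℝ 2 ψ A ∧ ∀ x ∈ A, eigs (hessianMatrix ψ x) ∈ Γ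

/-- Viscosity subsolution of `F(D²u) = g` on `Ω` (for `F` of the form `f(λ(D²u))`). -/
def ViscSubsolution {n : ℕ} (Γ : Set (Fin n → ℝ)) (F : Matrix (Fin n) (Fin n) ℝ → ℝ)
    (g : EuclideanSpace ℝ (Fin n) → ℝ) (Ω : Set (EuclideanSpace ℝ (Fin n)))
    (u : EuclideanSpace ℝ (Fin n) → ℝ) : Prop :=
  UpperSemicontinuousOn u Ω ∧
    ∀ Aset : Set (EuclideanSpace ℝ (Fin n)), Aset ⊆ Ω → IsOpen Aset →
      ∀ ψ : EuclideanSpace ℝ (Fin n) → ℝ, Admissible Γ Aset ψ →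
        ∀ x₀ ∈ Aset, IsLocalMaxOn (fun y => u y - ψ y) Aset x₀ →
          g x₀ ≤ F (hessianMatrix ψ x₀)

/-- Viscosity supersolution of `F(D²u) = g` on `Ω`. -/
def ViscSupersolution {n : ℕ} (Γ : Set (Fin n → ℝ)) (F : Matrix (Fin n) (Fin n) ℝ → ℝ)
    (g : EuclideanSpace ℝ (Fin n) → ℝ) (Ω : Set (EuclideanSpace ℝ (Fin n)))
    (u : EuclideanSpace ℝ (Fin n) → ℝ) : Prop :=
  LowerSemicontinuousOn u Ω ∧
    ∀ Aset : Set (EuclideanSpace ℝ (Fin n)), Aset ⊆ Ω → IsOpen Aset →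
      ∀ ψ : EuclideanSpace ℝ (Fin n) → ℝ, Admissible Γ Aset ψ →
        ∀ x₀ ∈ Aset, IsLocalMinOn (fun y => u y - ψ y) Aset x₀ →
          F (hessianMatrix ψ x₀) ≤ g x₀

end

section MatrixDeterminant

open Matrix Polynomial

theorem det_diagonal_add_vecMulVec_of_field {ι K : Type*} [Fintype ι] [DecidableEq ι] [Field K]
    (d u v : ι → K) (hd : ∀ i, d i ≠ 0) :
    (diagonal d + vecMulVec u v).det =
      ∏ i, d i + ∑ i, u i * v i * ∏ j ∈ Finset.univ.erase i, d j := by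
  have hfac : diagonal d + vecMulVec u v =
      diagonal d * (1 + replicateCol Unit (fun i => u i / d i) * replicateRow Unit v) := by
    rw [mul_add, mul_one]
    congr 1
    ext i j
    rw [diagonal_mul, mul_apply, Fintype.sum_unique, replicateCol_apply, replicateRow_apply,
      vecMulVec_apply]
    field_simp [hd i]
  rw [hfac, det_mul, det_diagonal, det_one_add_replicateCol_mul_replicateRow, mul_add, mul_one,
    dotProduct, Finset.mul_sum]
  congr 1
  refine Finset.sum_congr rfl fun i _ => ?_
  rw [← Finset.mul_prod_erase _ _ (Finset.mem_univ i)]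
  field_simp [hd i]

theorem det_diagonal_add_vecMulVec {ι R : Type*} [Fintype ι] [DecidableEq ι] [CommRing R]
    [IsDomain R] (d u v : ι → R) (hd : ∀ i, d i ≠ 0) :
    (diagonal d + vecMulVec u v).det =
      ∏ i, d i + ∑ i, u i * v i * ∏ j ∈ Finset.univ.erase i, d j := by
  have hinj := IsFractionRing.injective R (FractionRing R)
  apply hinj
  have hfield := det_diagonal_add_vecMulVec_of_field (fun i => algebraMap R (FractionRing R) (d i))
    (fun i => algebraMap R (FractionRing R) (u i)) (fun i => algebraMap R (FractionRing R) (v i))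
    (fun i => (map_ne_zero_iff _ hinj).2 (hd i))
  rw [RingHom.map_det]
  simp only [map_add, map_sum, map_prod, map_mul]
  rw [← hfield]
  congr 1
  ext i j
  rcases eq_or_ne i j with rfl | hij
  · simp [vecMulVec_apply]
  · simp [vecMulVec_apply, hij]

theorem X_mul_charpoly_diagonal_add_smul_vecMulVec {ι R : Type*} [Fintype ι] [DecidableEq ι]
    [CommRing R] [IsDomain R] (b v : ι → R) (c : R) :
    X * (diagonal b + c • vecMulVec v v).charpoly =
      X * ∏ i, (X - C (b i)) -
        C c * ∑ i, C (v i ^ 2) * ∏ j, (X - C (Function.update b i 0 j)) := by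
  have hmat : (diagonal b + c • vecMulVec v v).charmatrix =
      diagonal (fun i => X - C (b i)) + vecMulVec (fun i => -C (c * v i)) (fun i => C (v i)) := by
    ext i j : 1
    rcases eq_or_ne i j with rfl | hij
    · simp [charmatrix_apply_eq, vecMulVec_apply]
      ring
    · simp [vecMulVec_apply, hij]
      ring
  rw [Matrix.charpoly, hmat, det_diagonal_add_vecMulVec _ _ _ fun i => X_sub_C_ne_zero (b i),
    mul_add, sub_eq_add_neg, Finset.mul_sum, Finset.mul_sum, ← Finset.sum_neg_distrib]
  congr 1
  refine Finset.sum_congr rfl fun i _ => ?_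
  rw [← Finset.mul_prod_erase _ _ (Finset.mem_univ i)]
  have herase : ∏ j ∈ Finset.univ.erase i, (X - C (Function.update b i 0 j)) =
      ∏ j ∈ Finset.univ.erase i, (X - C (b j)) :=
    Finset.prod_congr rfl fun j hj => by rw [Function.update_of_ne (Finset.ne_of_mem_erase hj)]
  rw [herase, Function.update_self]
  simp only [map_zero, sub_zero, map_mul, map_pow]
  ring

end MatrixDeterminant

section ElementarySymmetric

open Polynomial

theorem coeff_prod_X_sub_C_eq_esym {n j : ℕ} (hj : j ≤ n) (lam : Fin n → ℝ) :
    (∏ i, (X - C (lam i))).coeff (n - j) = (-1) ^ j * esym n j lam := by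
  have h := Multiset.prod_X_sub_C_coeff (Finset.univ.val.map lam) (k := n - j) (by simp)
  rw [Multiset.map_map, Finset.esymm_map_val] at h
  have hsub : n - (n - j) = j := by omega
  rw [Multiset.card_map, Finset.card_val, Finset.card_univ, Fintype.card_fin, hsub] at h
  exact h

theorem esym_comp_equiv {n : ℕ} (k : ℕ) (lam : Fin n → ℝ) (e : Equiv.Perm (Fin n)) (hk : k ≤ n) :
    esym n k (lam ∘ e) = esym n k lam := by
  have h := coeff_prod_X_sub_C_eq_esym hk (lam ∘ e)
  simp only [Function.comp_apply] at h
  rw [Equiv.prod_comp e (fun i => X - C (lam i)), coeff_prod_X_sub_C_eq_esym hk] at h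
  exact (mul_left_cancel₀ (pow_ne_zero _ (by norm_num)) h).symm

theorem esym_const_mul {n : ℕ} (k : ℕ) (c : ℝ) (lam : Fin n → ℝ) :
    esym n k (fun i => c * lam i) = c ^ k * esym n k lam := by
  rw [esym, esym, Finset.mul_sum]
  refine Finset.sum_congr rfl fun S hS => ?_
  rw [Finset.prod_mul_distrib, Finset.prod_const, (Finset.mem_powersetCard.1 hS).2]

theorem esymRem_const_mul {n : ℕ} (k : ℕ) (c : ℝ) (lam : Fin n → ℝ) (i : Fin n) :
    esymRem n k (fun i => c * lam i) i = c ^ k * esymRem n k lam i := by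
  rw [esymRem, esymRem, ← esym_const_mul]
  congr 1
  ext j
  rcases eq_or_ne j i with rfl | h
  · simp
  · simp [h]

theorem coeff_charpoly_eq_esym_eigs {n k : ℕ} (hk : k ≤ n) {M : Matrix (Fin n) (Fin n) ℝ}
    (hM : M.IsHermitian) : M.charpoly.coeff (n - k) = (-1) ^ k * esym n k (eigs M) := by
  rw [eigs, dif_pos hM, esym_comp_equiv k _ _ hk, ← coeff_prod_X_sub_C_eq_esym hk, hM.charpoly_eq]
  rfl

theorem esym_eigs_diagonal_add_smul_vecMulVec {n k : ℕ} (hk1 : 1 ≤ k) (hk : k ≤ n)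
    (b v : Fin n → ℝ) (c : ℝ) :
    esym n k (eigs (Matrix.diagonal b + c • Matrix.vecMulVec v v)) =
      esym n k b + c * ∑ i, esymRem n (k - 1) b i * v i ^ 2 := by
  have hM : (Matrix.diagonal b + c • Matrix.vecMulVec v v).IsHermitian := by
    ext i j
    simp [Matrix.vecMulVec_apply, Matrix.diagonal_apply, eq_comm]
    split_ifs with h
    · subst h; ring
    · ring
  have h := congrArg (fun p => p.coeff (n - k + 1))
    (X_mul_charpoly_diagonal_add_smul_vecMulVec b v c)
  have hdeg : n - k + 1 = n - (k - 1) := by omega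
  simp only [coeff_sub, coeff_X_mul, coeff_C_mul, finsetSum_coeff] at h
  simp only [hdeg, coeff_charpoly_eq_esym_eigs hk hM, coeff_prod_X_sub_C_eq_esym hk,
    coeff_prod_X_sub_C_eq_esym (show k - 1 ≤ n by omega)] at h
  obtain ⟨m, rfl⟩ : ∃ m, k = m + 1 := ⟨k - 1, by omega⟩
  simp only [Nat.add_sub_cancel] at h ⊢
  have hsum : ∑ i, v i ^ 2 * ((-1) ^ m * esym n m (Function.update b i 0)) =
      (-1) ^ m * ∑ i, esymRem n m b i * v i ^ 2 := by
    rw [Finset.mul_sum]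
    exact Finset.sum_congr rfl fun i _ => by rw [esymRem]; ring
  rw [hsum] at h
  refine mul_left_cancel₀ (pow_ne_zero (m + 1) (show (-1 : ℝ) ≠ 0 by norm_num)) ?_
  rw [h]
  ring

end ElementarySymmetric

section Hessian

variable {n : ℕ}

theorem quadForm_diagonal (a : Fin n → ℝ) (x : EuclideanSpace ℝ (Fin n)) :
    quadForm (Matrix.diagonal a) x = (1 / 2) * ∑ i, a i * x i ^ 2 := by
  rw [quadForm]
  congr 1
  refine Finset.sum_congr rfl fun i _ => ?_
  rw [Finset.sum_eq_single i (fun j _ hj => by simp [hj.symm]) (by simp), Matrix.diagonal_apply_eq]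
  ring

theorem hasFDerivAt_quadForm_diagonal (a : Fin n → ℝ) (x : EuclideanSpace ℝ (Fin n)) :
    HasFDerivAt (quadForm (Matrix.diagonal a))
      (∑ i, (a i * x i) • (EuclideanSpace.proj i : EuclideanSpace ℝ (Fin n) →L[ℝ] ℝ)) x := by
  have h : HasFDerivAt (fun y : EuclideanSpace ℝ (Fin n) => (1 / 2) * ∑ i, a i * y i ^ 2)
      ((1 / 2 : ℝ) • ∑ i, a i • ((2 * x i ^ (2 - 1)) •
        (EuclideanSpace.proj i : EuclideanSpace ℝ (Fin n) →L[ℝ] ℝ))) x := by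
    refine HasFDerivAt.const_mul (HasFDerivAt.fun_sum fun i _ => HasFDerivAt.const_mul ?_ _) _
    simpa using (EuclideanSpace.proj i : EuclideanSpace ℝ (Fin n) →L[ℝ] ℝ).hasFDerivAt.pow 2
      (x := x)
  rw [funext (quadForm_diagonal a)]
  convert h using 1
  rw [Finset.smul_sum]
  refine Finset.sum_congr rfl fun i _ => ?_
  rw [smul_smul, smul_smul]
  congr 1
  ring

theorem sum_smul_proj_single (b : Fin n → ℝ) (j : Fin n) :
    (∑ i, b i • (EuclideanSpace.proj i : EuclideanSpace ℝ (Fin n) →L[ℝ] ℝ))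
      (EuclideanSpace.single j 1) = b j := by
  simp

theorem hessianMatrix_comp_quadForm_diagonal (a : Fin n → ℝ) {f : ℝ → ℝ} (hf : ContDiff ℝ 2 f)
    (x : EuclideanSpace ℝ (Fin n)) :
    hessianMatrix (fun y => f (quadForm (Matrix.diagonal a) y)) x =
      Matrix.diagonal (fun i => deriv f (quadForm (Matrix.diagonal a) x) * a i) +
        deriv (deriv f) (quadForm (Matrix.diagonal a) x) •
          Matrix.vecMulVec (fun i => a i * x i) (fun i => a i * x i) := by
  have hf' : Differentiable ℝ (deriv f) :=
    (ContDiff.deriv' (n := 1) (by rwa [one_add_one_eq_two])).differentiable (by norm_num)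
  ext i j
  have hgrad : (fun y => fderiv ℝ (fun z => f (quadForm (Matrix.diagonal a) z)) y
      (EuclideanSpace.single j 1)) =
      fun y => deriv f (quadForm (Matrix.diagonal a) y) * (a j * y j) := by
    ext y
    have h := ((hf.differentiable (by norm_num)).differentiableAt.hasDerivAt).comp_hasFDerivAt y
      (hasFDerivAt_quadForm_diagonal a y)
    rw [HasFDerivAt.fderiv (f := fun z => f (quadForm (Matrix.diagonal a) z)) h,
      smul_apply, sum_smul_proj_single _ j, smul_eq_mul]
  have hout := (hf' (quadForm (Matrix.diagonal a) x)).hasDerivAt.comp_hasFDerivAt x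
    (hasFDerivAt_quadForm_diagonal a x)
  have hlin : HasFDerivAt (fun y : EuclideanSpace ℝ (Fin n) => a j * y j)
      (a j • (EuclideanSpace.proj j : EuclideanSpace ℝ (Fin n) →L[ℝ] ℝ)) x :=
    (EuclideanSpace.proj j : EuclideanSpace ℝ (Fin n) →L[ℝ] ℝ).hasFDerivAt.const_mul (a j)
  have hprod := HasFDerivAt.mul hout hlin
  rw [hessianMatrix, hgrad, HasFDerivAt.fderiv
    (f := fun y => deriv f (quadForm (Matrix.diagonal a) y) * (a j * y j)) hprod, add_apply,
    smul_apply, smul_apply, smul_apply, smul_apply, sum_smul_proj_single _ i]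
  rcases eq_or_ne i j with rfl | hij
  · simp [Matrix.vecMulVec_apply]
    ring
  · simp [Matrix.vecMulVec_apply, hij, hij.symm]
    ring

end Hessian

/-- **k-Hessians of generalized symmetric functions** (Lemma 2.2 / `G-lem:k-He-G-Sym`).
If `w(x) = f(½xᵀAx)` with `A = diag(a₁,…,aₙ)` and `f ∈ C²`, then
`σ_k(λ(D²w)) = σ_k(a) f'(s)^k + f''(s) f'(s)^{k-1} Σᵢ σ_{k-1;i}(a) (aᵢxᵢ)²`. -/
theorem kHessian_generalized_symmetric
    (n : ℕ) (a : Fin n → ℝ) (f : ℝ → ℝ) (hf : ContDiff ℝ 2 f)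
    (w : EuclideanSpace ℝ (Fin n) → ℝ)
    (hw : ∀ x, w x = f (quadForm (Matrix.diagonal a) x))
    (k : ℕ) (hk1 : 1 ≤ k) (hk2 : k ≤ n) (x : EuclideanSpace ℝ (Fin n)) :
    esym n k (eigs (hessianMatrix w x)) =
      esym n k a * (deriv f (quadForm (Matrix.diagonal a) x)) ^ k +
        deriv (deriv f) (quadForm (Matrix.diagonal a) x) *
          (deriv f (quadForm (Matrix.diagonal a) x)) ^ (k - 1) *
          ∑ i, esymRem n (k - 1) a i * (a i * x i) ^ 2 := by
  obtain rfl : w = fun y => f (quadForm (Matrix.diagonal a) y) := funext hw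
  rw [hessianMatrix_comp_quadForm_diagonal a hf, esym_eigs_diagonal_add_smul_vecMulVec hk1 hk2,
    esym_const_mul]
  simp only [esymRem_const_mul, mul_assoc, ← Finset.mul_sum]
  ring
end

section
/- Let n ≥ 3 and 0 ≤ l < k ≤ n. If k − l ≥ 3, or k − l = 2 and k < n, then 𝒜_{k,l} = 𝒜ˢ_{k,l}; that is, every A ∈ S⁺(n) with S_{k,l}(A) = 1 satisfies H_k(A) < (k−l)/2. -/
open scoped BigOperators
open Filter MeasureTheory

lemma esym_succ_eq_add (n k : ℕ) (lam : Fin n → ℝ) (i : Fin n) :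
    esym n (k + 1) lam =
      (∑ S ∈ Finset.powersetCard (k + 1) (Finset.univ.erase i), ∏ j ∈ S, lam j) +
        lam i * ∑ S ∈ Finset.powersetCard k (Finset.univ.erase i), ∏ j ∈ S, lam j := by
  have hi : ∀ m, ∀ S ∈ Finset.powersetCard m (Finset.univ.erase i), i ∉ S := fun m S hS h ↦
    Finset.notMem_erase i _ ((Finset.mem_powersetCard.1 hS).1 h)
  unfold esym
  rw [← Finset.insert_erase (Finset.mem_univ i),
    Finset.powersetCard_succ_insert (Finset.notMem_erase i _),
    Finset.insert_erase (Finset.mem_univ i), Finset.sum_union, Finset.sum_image, Finset.mul_sum]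
  · exact congrArg _ (Finset.sum_congr rfl fun S hS ↦ Finset.prod_insert (hi _ S hS))
  · intro S hS T hT hST
    rw [← Finset.erase_insert (hi _ S hS), ← Finset.erase_insert (hi _ T hT)]
    exact congrArg (fun U : Finset (Fin n) ↦ U.erase i) hST
  · refine Finset.disjoint_left.2 fun S hS hS' ↦ ?_
    obtain ⟨T, -, rfl⟩ := Finset.mem_image.1 hS'
    exact hi _ _ hS (Finset.mem_insert_self i T)

lemma esymRem_eq_sum_erase (n k : ℕ) (lam : Fin n → ℝ) (i : Fin n) :
    esymRem n k lam i =
      ∑ S ∈ Finset.powersetCard k (Finset.univ.erase i), ∏ j ∈ S, lam j := by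
  cases k with
  | zero => simp [esymRem, esym]
  | succ k =>
    rw [esymRem, esym_succ_eq_add n k _ i, Function.update_self, zero_mul, add_zero]
    refine Finset.sum_congr rfl fun S hS ↦ Finset.prod_congr rfl fun j hj ↦ ?_
    exact Function.update_of_ne
      (Finset.ne_of_mem_erase ((Finset.mem_powersetCard.1 hS).1 hj)) _ _

lemma esym_succ_eq_esymRem_add (n k : ℕ) (lam : Fin n → ℝ) (i : Fin n) :
    esym n (k + 1) lam = esymRem n (k + 1) lam i + esymRem n k lam i * lam i := by
  rw [esym_succ_eq_add n k lam i, esymRem_eq_sum_erase, esymRem_eq_sum_erase, mul_comm]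

lemma esym_pos {n k : ℕ} {lam : Fin n → ℝ} (hpos : ∀ i, 0 < lam i) (hk : k ≤ n) :
    0 < esym n k lam :=
  Finset.sum_pos (fun _ _ ↦ Finset.prod_pos fun j _ ↦ hpos j)
    (Finset.powersetCard_nonempty.2 (by simpa using hk))

lemma esymRem_nonneg {n : ℕ} {lam : Fin n → ℝ} (hpos : ∀ i, 0 < lam i) (k : ℕ) (i : Fin n) :
    0 ≤ esymRem n k lam i := by
  rw [esymRem_eq_sum_erase]
  exact Finset.sum_nonneg fun _ _ ↦ Finset.prod_nonneg fun j _ ↦ (hpos j).le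

lemma esymRem_pos {n k : ℕ} {lam : Fin n → ℝ} (hpos : ∀ i, 0 < lam i) (hk : k < n) (i : Fin n) :
    0 < esymRem n k lam i := by
  rw [esymRem_eq_sum_erase]
  refine Finset.sum_pos (fun _ _ ↦ Finset.prod_pos fun j _ ↦ hpos j)
    (Finset.powersetCard_nonempty.2 ?_)
  rw [Finset.card_erase_of_mem (Finset.mem_univ i), Finset.card_univ, Fintype.card_fin]
  omega

lemma eigs_pos {n : ℕ} {A : Matrix (Fin n) (Fin n) ℝ} (hA : A.PosDef) (i : Fin n) :
    0 < eigs A i := by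
  rw [eigs, dif_pos hA.isHermitian]
  exact hA.eigenvalues_pos _

/-- **Proposition 2.4 (ii)**: if `k - l ≥ 3`, or `k - l = 2` and `k < n`, then
`𝒜_{k,l} = 𝒜ˢ_{k,l}`, i.e. every symmetric positive definite `A` with `S_{k,l}(A) = 1`
satisfies `H_k(A) < (k - l)/2`. -/
theorem Akl_eq_Askl
    (n k l : ℕ) (hn : 3 ≤ n) (hlk : l < k) (hkn : k ≤ n)
    (hcase : 3 ≤ k - l ∨ (k - l = 2 ∧ k < n))
    (A : Matrix (Fin n) (Fin n) ℝ) (hAsymm : A.IsSymm) (hApd : A.PosDef)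
    (hA1 : Skl n k l A = 1) :
    Hk n k A < ((k : ℝ) - l) / 2 := by
  obtain ⟨m, rfl⟩ : ∃ m, k = m + 1 := ⟨k - 1, by omega⟩
  have : Nonempty (Fin n) := ⟨⟨0, by omega⟩⟩
  obtain ⟨i, hi⟩ := exists_eq_ciSup_of_finite (f := fun i : Fin n ↦
    esymRem n (m + 1 - 1) (eigs A) i * eigs A i / esym n (m + 1) (eigs A))
  rw [Hk, ← hi, Nat.add_sub_cancel]
  have hpos := eigs_pos hApd
  have hσ := esym_pos hpos hkn
  have hsplit := esym_succ_eq_esymRem_add n m (eigs A) i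
  rw [div_lt_iff₀ hσ]
  rcases hcase with h | ⟨h, hlt⟩
  · have hkl : (3 : ℝ) ≤ ((m + 1 : ℕ) : ℝ) - l := by
      rw [le_sub_iff_add_le]
      exact_mod_cast (by omega : 3 + l ≤ m + 1)
    nlinarith [esymRem_nonneg hpos (m + 1) i]
  · have hkl : ((m + 1 : ℕ) : ℝ) - l = 2 := by
      rw [sub_eq_iff_eq_add]
      exact_mod_cast (by omega : m + 1 = 2 + l)
    rw [hkl]
    linarith [esymRem_pos hpos hlt i]
end

section
/- Let a = (a₁,…,aₙ) ∈ ℝⁿ with 0 < a₁ ≤ a₂ ≤ ⋯ ≤ aₙ, and let 1 ≤ m ≤ k ≤ n be integers. Then σ_m(a)·σ_{k−1;n}(a) ≥ σ_{m−1;n}(a)·σ_k(a). -/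
open scoped BigOperators
open Filter MeasureTheory

theorem Multiset.esymm_cons_succ {R : Type*} [CommSemiring R] (x : R) (s : Multiset R) (j : ℕ) :
    (x ::ₘ s).esymm (j + 1) = s.esymm (j + 1) + x * s.esymm j := by
  simp [Multiset.esymm, Multiset.powersetCard_cons, Multiset.sum_map_mul_left]

theorem Multiset.esymm_zero_right {R : Type*} [CommSemiring R] (s : Multiset R) :
    s.esymm 0 = 1 := by
  simp [Multiset.esymm]

theorem Multiset.esymm_nonneg {s : Multiset ℝ} (hs : ∀ x ∈ s, 0 ≤ x) (j : ℕ) :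
    0 ≤ s.esymm j := by
  refine Multiset.sum_nonneg fun y hy => ?_
  obtain ⟨t, ht, rfl⟩ := Multiset.mem_map.1 hy
  exact Multiset.prod_nonneg fun x hx =>
    hs x (Multiset.mem_of_le (Multiset.mem_powersetCard.1 ht).1 hx)

/-- The elementary symmetric functions of nonnegative reals form a log-concave sequence. -/
theorem Multiset.esymm_mul_esymm_succ_le {s : Multiset ℝ} (hs : ∀ x ∈ s, 0 ≤ x) {m k : ℕ}
    (hmk : m ≤ k) : s.esymm m * s.esymm (k + 1) ≤ s.esymm (m + 1) * s.esymm k := by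
  induction s using Multiset.induction_on generalizing m k with
  | empty => simp [Multiset.esymm, Multiset.powersetCard_zero_right]
  | cons x s ih =>
    have hx : 0 ≤ x := hs x (Multiset.mem_cons_self x s)
    have hs' : ∀ y ∈ s, 0 ≤ y := fun y hy => hs y (Multiset.mem_cons_of_mem hy)
    have hnn := Multiset.esymm_nonneg hs'
    rcases k with _ | k
    · obtain rfl : m = 0 := by omega
      rw [mul_comm]
    rcases m with _ | m
    · have h := ih hs' (Nat.zero_le (k + 1))
      simp only [Multiset.esymm_cons_succ, Multiset.esymm_zero_right, one_mul, zero_add,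
        mul_one] at h ⊢
      nlinarith [mul_nonneg (mul_nonneg hx (hnn 1)) (hnn k),
        mul_nonneg (mul_nonneg hx hx) (hnn k)]
    · have h₀ := ih hs' hmk
      have h₂ := ih hs' (Nat.le_of_succ_le_succ hmk)
      have h₁ : s.esymm m * s.esymm (k + 2) ≤ s.esymm (m + 2) * s.esymm k := by
        rcases hmk.eq_or_lt with h | h
        · obtain rfl : m = k := by omega
          rw [mul_comm]
        · exact (ih hs' (by omega : m ≤ k + 1)).trans (ih hs' (by omega : m + 1 ≤ k))
      simp only [Multiset.esymm_cons_succ]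
      linarith [mul_le_mul_of_nonneg_left h₁ hx,
        mul_le_mul_of_nonneg_left h₂ (mul_nonneg hx hx)]

theorem esym_eq_multiset_esymm (n j : ℕ) (a : Fin n → ℝ) (i : Fin n) :
    esym n j a = (a i ::ₘ (Finset.univ.erase i).val.map a).esymm j := by
  rw [esym, ← Finset.esymm_map_val, ← Multiset.map_cons, ← Finset.insert_val_of_notMem (by simp),
    Finset.insert_erase (Finset.mem_univ i)]

theorem esymRem_eq_multiset_esymm (n j : ℕ) (a : Fin n → ℝ) (i : Fin n) :
    esymRem n j a i = ((Finset.univ.erase i).val.map a).esymm j := by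
  have h : (Finset.univ.erase i).val.map (Function.update a i 0) =
      (Finset.univ.erase i).val.map a :=
    Multiset.map_congr rfl fun x hx =>
      Function.update_of_ne (Finset.ne_of_mem_erase (Finset.mem_def.2 hx)) _ _
  rw [esymRem, esym_eq_multiset_esymm n j _ i, h, Function.update_self]
  cases j <;> simp [Multiset.esymm_cons_succ, Multiset.esymm_zero_right]

/-- **Newton-type inequality**: for `0 < a₁ ≤ ⋯ ≤ aₙ` and `1 ≤ m ≤ k ≤ n`,
`σ_m(a) σ_{k-1;n}(a) ≥ σ_{m-1;n}(a) σ_k(a)`. -/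
theorem esym_product_inequality
    (n : ℕ) (a : Fin n → ℝ) (hapos : ∀ i, 0 < a i) (hmono : Monotone a)
    (m k : ℕ) (hm1 : 1 ≤ m) (hmk : m ≤ k) (hkn : k ≤ n) :
    esymRem n (m - 1) a ⟨n - 1, by omega⟩ * esym n k a ≤
      esym n m a * esymRem n (k - 1) a ⟨n - 1, by omega⟩ := by
  obtain ⟨m, rfl⟩ := Nat.exists_eq_succ_of_ne_zero (by omega : m ≠ 0)
  obtain ⟨k, rfl⟩ := Nat.exists_eq_succ_of_ne_zero (by omega : k ≠ 0)
  generalize_proofs hn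
  set i : Fin n := ⟨n - 1, hn⟩
  have hs : ∀ x ∈ (Finset.univ.erase i).val.map a, 0 ≤ x := fun x hx => by
    obtain ⟨j, -, rfl⟩ := Multiset.mem_map.1 hx
    exact (hapos j).le
  have h := Multiset.esymm_mul_esymm_succ_le hs (Nat.le_of_succ_le_succ hmk)
  simp only [esymRem_eq_multiset_esymm, esym_eq_multiset_esymm n _ a i, Nat.succ_eq_add_one,
    Nat.add_sub_cancel, Multiset.esymm_cons_succ]
  linarith
end

section
/- Let A be a real n×n symmetric positive definite matrix and let 1 ≤ m ≤ k ≤ n be integers. Then H_m(A) ≤ H_k(A); equivalently, σ_{m−1;n}(λ(A))λ_n(A)/σ_m(λ(A)) ≤ σ_{k−1;n}(λ(A))λ_n(A)/σ_k(λ(A)). -/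
open scoped BigOperators
open Filter MeasureTheory

/-- The `j`-th elementary symmetric function of the variables `x i`, `i ∈ s`. -/
def esymOn {ι : Type*} (x : ι → ℝ) (s : Finset ι) (j : ℕ) : ℝ :=
  ∑ T ∈ s.powersetCard j, ∏ i ∈ T, x i

lemma esymOn_zero {ι : Type*} (x : ι → ℝ) (s : Finset ι) : esymOn x s 0 = 1 := by
  simp [esymOn]

lemma esymOn_insert_succ {ι : Type*} [DecidableEq ι] (x : ι → ℝ) {a : ι} {s : Finset ι}
    (ha : a ∉ s) (j : ℕ) :
    esymOn x (insert a s) (j + 1) = esymOn x s (j + 1) + x a * esymOn x s j := by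
  have hT : ∀ T ∈ s.powersetCard j, a ∉ T := fun T hT h =>
    ha ((Finset.mem_powersetCard.1 hT).1 h)
  unfold esymOn
  rw [Finset.powersetCard_succ_insert ha, Finset.sum_union, Finset.sum_image, Finset.mul_sum]
  · congr 1
    exact Finset.sum_congr rfl fun T h => Finset.prod_insert (hT T h)
  · intro T h T' h' hTT'
    rw [← Finset.erase_insert (hT T h), ← Finset.erase_insert (hT T' h'), hTT']
  · rw [Finset.disjoint_left]
    intro T h h'
    obtain ⟨U, -, rfl⟩ := Finset.mem_image.1 h'
    exact ha ((Finset.mem_powersetCard.1 h).1 (Finset.mem_insert_self a U))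

lemma esymOn_congr {ι : Type*} {x y : ι → ℝ} {s : Finset ι} (h : ∀ i ∈ s, x i = y i) (j : ℕ) :
    esymOn x s j = esymOn y s j :=
  Finset.sum_congr rfl fun _ hT => Finset.prod_congr rfl fun i hi =>
    h i ((Finset.mem_powersetCard.1 hT).1 hi)

lemma esymOn_nonneg {ι : Type*} {x : ι → ℝ} (hx : ∀ i, 0 ≤ x i) (s : Finset ι) (j : ℕ) :
    0 ≤ esymOn x s j :=
  Finset.sum_nonneg fun _ _ => Finset.prod_nonneg fun i _ => hx i

lemma esymOn_pos {ι : Type*} {x : ι → ℝ} (hx : ∀ i, 0 < x i) {s : Finset ι} {j : ℕ}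
    (hj : j ≤ s.card) : 0 < esymOn x s j :=
  Finset.sum_pos (fun _ _ => Finset.prod_pos fun i _ => hx i)
    (Finset.powersetCard_nonempty.2 hj)

/-- Log-concavity of the elementary symmetric functions of nonnegative variables. -/
lemma esymOn_mul_succ_le {ι : Type*} {x : ι → ℝ} (hx : ∀ i, 0 ≤ x i) (s : Finset ι) :
    ∀ {i j : ℕ}, i ≤ j →
      esymOn x s i * esymOn x s (j + 1) ≤ esymOn x s (i + 1) * esymOn x s j := by
  classical
  induction s using Finset.induction_on with
  | empty =>
    intro i j _
    have h (l : ℕ) : esymOn x ∅ (l + 1) = 0 := by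
      rw [esymOn, Finset.powersetCard_eq_empty.2 (by simp), Finset.sum_empty]
    simp [h]
  | insert a s ha ih =>
    have hnn := esymOn_nonneg hx s
    have hxa := hx a
    rintro (_ | i) (_ | j) hij
    · simp [esymOn_zero]
    · simp only [esymOn_insert_succ x ha, esymOn_zero]
      have h0 := ih (Nat.zero_le (j + 1))
      simp only [esymOn_zero, zero_add] at h0 ⊢
      nlinarith [mul_nonneg hxa (mul_nonneg (hnn 1) (hnn j)),
        mul_nonneg hxa (mul_nonneg hxa (hnn j))]
    · omega
    · simp only [esymOn_insert_succ x ha]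
      have h0 := ih hij
      have h2 := ih (Nat.le_of_succ_le_succ hij)
      have h1 : esymOn x s i * esymOn x s (j + 1 + 1) ≤ esymOn x s (i + 1 + 1) * esymOn x s j := by
        rcases (Nat.le_of_succ_le_succ hij).eq_or_lt with rfl | hlt
        · exact (mul_comm _ _).le
        · exact (ih (Nat.le_of_lt (Nat.lt_succ_of_lt hlt))).trans (ih hlt)
      nlinarith [mul_nonneg hxa (sub_nonneg.2 h1),
        mul_nonneg (mul_nonneg hxa hxa) (sub_nonneg.2 h2)]

lemma esymRem_eq_esymOn {n : ℕ} (x : Fin n → ℝ) (i : Fin n) (j : ℕ) :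
    esymRem n j x i = esymOn x (Finset.univ.erase i) j := by
  change esymOn (Function.update x i 0) Finset.univ j = _
  cases j with
  | zero => simp [esymOn_zero]
  | succ j =>
    rw [← Finset.insert_erase (Finset.mem_univ i),
      esymOn_insert_succ _ (Finset.notMem_erase i _), Function.update_self, zero_mul, add_zero,
      Finset.insert_erase (Finset.mem_univ i)]
    exact esymOn_congr (fun l hl => Function.update_of_ne (Finset.ne_of_mem_erase hl) _ _) _

lemma esym_succ_eq_add_s14 {n : ℕ} (x : Fin n → ℝ) (i : Fin n) (j : ℕ) :
    esym n (j + 1) x = esymRem n (j + 1) x i + x i * esymRem n j x i := by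
  rw [esymRem_eq_esymOn, esymRem_eq_esymOn, ← esymOn_insert_succ x (Finset.notMem_erase i _),
    Finset.insert_erase (Finset.mem_univ i)]
  rfl

lemma esymRem_mul_div_esym_le {n m k : ℕ} (hmk : m ≤ k) (hkn : k + 1 ≤ n) {x : Fin n → ℝ}
    (hx : ∀ i, 0 < x i) (i : Fin n) :
    esymRem n m x i * x i / esym n (m + 1) x ≤ esymRem n k x i * x i / esym n (k + 1) x := by
  have hpos : ∀ {j : ℕ}, j ≤ n → 0 < esym n j x := fun hj => esymOn_pos hx (by simpa using hj)
  rw [div_le_div_iff₀ (hpos (by omega)) (hpos hkn), esym_succ_eq_add_s14 x i k,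
    esym_succ_eq_add_s14 x i m]
  have h := esymOn_mul_succ_le (fun l => (hx l).le) (Finset.univ.erase i) hmk
  simp only [← esymRem_eq_esymOn] at h
  nlinarith [mul_nonneg (hx i).le (sub_nonneg.2 h)]

/-- **Monotonicity of `H_k`**: for a symmetric positive definite matrix `A` and
`1 ≤ m ≤ k ≤ n`, `H_m(A) ≤ H_k(A)`. -/
theorem Hk_monotone
    (n m k : ℕ) (hm1 : 1 ≤ m) (hmk : m ≤ k) (hkn : k ≤ n)
    (A : Matrix (Fin n) (Fin n) ℝ) (hAsymm : A.IsSymm) (hApd : A.PosDef) :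
    Hk n m A ≤ Hk n k A := by
  obtain ⟨m, rfl⟩ := Nat.exists_eq_add_of_le' hm1
  obtain ⟨k, rfl⟩ := Nat.exists_eq_add_of_le' (hm1.trans hmk)
  exact ciSup_mono (Set.finite_range _).bddAbove
    (esymRem_mul_div_esym_le (Nat.le_of_succ_le_succ hmk) hkn (eigs_pos hApd))
end

section
/- Let m ≥ 1 be an integer, β > 0, C₀ > 0, ℋ > 0, ḡ(t) := 1 + C₀ t^{−β/2}, set H := m/(2ℋ), and let c₁ > C̃, where C̃ > 1 is such that G(s) := ∫_1^s ℋ t^{ℋ−1} ḡ(t) dt + c₁ − s^{ℋ} ḡ(s) > 0 for all s ≥ 1. Let W(s) := ( s^{−ℋ}( ∫_1^s ℋ t^{ℋ−1} ḡ(t) dt + c₁ ) )^{1/m}. Then for all s ≥ 1: H·W'(s)/W(s) ≥ −1/(2s), and consequently W(s) + 2H·W'(s)·s > 0. -/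
open scoped BigOperators
open Filter MeasureTheory

/-- `ḡ(t) = 1 + C₀ t^{-β/2}`. -/
noncomputable def gbar (C₀ β t : ℝ) : ℝ := 1 + C₀ * t ^ (-β / 2)

/-- `W(s) = ( s^{-ℋ} ( ∫₁ˢ ℋ t^{ℋ-1} ḡ(t) dt + c₁ ) )^{1/m}`. -/
noncomputable def Wsub (m : ℕ) (Hc C₀ β c₁ : ℝ) (s : ℝ) : ℝ :=
  (s ^ (-Hc) * ((∫ t in (1:ℝ)..s, Hc * t ^ (Hc - 1) * gbar C₀ β t) + c₁)) ^ ((1 : ℝ) / m)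

/-- `G(s) = ∫₁ˢ ℋ t^{ℋ-1} ḡ(t) dt + c₁ - s^{ℋ} ḡ(s)`. -/
noncomputable def Gfun (Hc C₀ β c₁ : ℝ) (s : ℝ) : ℝ :=
  (∫ t in (1:ℝ)..s, Hc * t ^ (Hc - 1) * gbar C₀ β t) + c₁ - s ^ Hc * gbar C₀ β s

/-- `ḡ > 0` on the positive half-line. -/
theorem gbar_pos {C₀ β t : ℝ} (hC₀ : 0 < C₀) (ht : 0 < t) : 0 < gbar C₀ β t := by
  unfold gbar
  positivity

/-- The integrand `ℋ t^{ℋ-1} ḡ(t)` is continuous away from `0`. -/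
theorem continuousAt_mul_rpow_mul_gbar (Hc C₀ β : ℝ) {t : ℝ} (ht : t ≠ 0) :
    ContinuousAt (fun t : ℝ => Hc * t ^ (Hc - 1) * gbar C₀ β t) t := by
  unfold gbar
  exact (continuousAt_const.mul (Real.continuousAt_rpow_const _ _ (Or.inl ht))).mul
    (continuousAt_const.add
      (continuousAt_const.mul (Real.continuousAt_rpow_const _ _ (Or.inl ht))))

theorem hasDerivAt_integral_mul_rpow_mul_gbar (Hc C₀ β : ℝ) {s : ℝ} (hs : 0 < s) :
    HasDerivAt (fun s : ℝ => ∫ t in (1:ℝ)..s, Hc * t ^ (Hc - 1) * gbar C₀ β t)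
      (Hc * s ^ (Hc - 1) * gbar C₀ β s) s := by
  have hcont : ContinuousOn (fun t : ℝ => Hc * t ^ (Hc - 1) * gbar C₀ β t) (Set.Ioi 0) :=
    fun t ht => (continuousAt_mul_rpow_mul_gbar Hc C₀ β (ne_of_gt ht)).continuousWithinAt
  refine intervalIntegral.integral_hasDerivAt_right ?_
    (hcont.stronglyMeasurableAtFilter isOpen_Ioi s hs)
    (continuousAt_mul_rpow_mul_gbar Hc C₀ β hs.ne')
  refine (hcont.mono fun t ht => ?_).intervalIntegrable
  exact lt_of_lt_of_le (lt_min one_pos hs) ht.1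

/-- Logarithmic derivative of `W`, where `A` is the value of the inner integral plus `c₁`. -/
theorem hasDerivAt_Wsub (m : ℕ) (Hc C₀ β c₁ : ℝ) {s A : ℝ} (hs : 0 < s) (hA : 0 < A)
    (hAs : (∫ t in (1:ℝ)..s, Hc * t ^ (Hc - 1) * gbar C₀ β t) + c₁ = A) :
    HasDerivAt (Wsub m Hc C₀ β c₁)
      (Hc / (m * s) * (s ^ Hc * gbar C₀ β s / A - 1) * Wsub m Hc C₀ β c₁ s) s := by
  have hinner := (Real.hasDerivAt_rpow_const (p := -Hc) (Or.inl hs.ne')).mul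
    ((hasDerivAt_integral_mul_rpow_mul_gbar Hc C₀ β hs).add_const c₁)
  have hpos : 0 < s ^ (-Hc) * A := by positivity
  have hW := hinner.rpow_const (p := (1 : ℝ) / m) (Or.inl (by simpa [hAs] using hpos.ne'))
  refine hW.congr_deriv ?_
  simp only [Wsub, Pi.mul_apply, hAs]
  rw [Real.rpow_sub_one hpos.ne', Real.rpow_sub_one hs.ne', Real.rpow_sub_one hs.ne',
    Real.rpow_neg hs.le]
  have hp : 0 < s ^ Hc := by positivity
  field_simp
  ring

/-- **Part (b) of Subsection 2.2 (key ratio estimate)**: with `H = m/(2ℋ)` and `c₁ > C̃`,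
where `C̃ > 1` is such that `G > 0` on `[1, ∞)`, one has `H·W'(s)/W(s) ≥ -1/(2s)` and hence
`W(s) + 2H·W'(s)·s > 0` for all `s ≥ 1`. -/
theorem Wsub_ratio_bound
    (m : ℕ) (hm : 1 ≤ m) (β C₀ Hc : ℝ) (hβ : 0 < β) (hC₀ : 0 < C₀) (hHc : 0 < Hc)
    (Ct c₁ : ℝ) (hCt : 1 < Ct) (hc₁ : Ct < c₁)
    (hG : ∀ s : ℝ, 1 ≤ s → 0 < Gfun Hc C₀ β c₁ s) :
    ∀ s : ℝ, 1 ≤ s →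
      -(1 / (2 * s)) ≤ (m : ℝ) / (2 * Hc) * deriv (Wsub m Hc C₀ β c₁) s / Wsub m Hc C₀ β c₁ s ∧
      0 < Wsub m Hc C₀ β c₁ s +
            2 * ((m : ℝ) / (2 * Hc)) * deriv (Wsub m Hc C₀ β c₁) s * s := by
  intro s hs
  have hs0 : 0 < s := by linarith
  have hm0 : (0 : ℝ) < m := by exact_mod_cast hm
  have hg : 0 < s ^ Hc * gbar C₀ β s :=
    mul_pos (Real.rpow_pos_of_pos hs0 _) (gbar_pos hC₀ hs0)
  obtain ⟨A, hAs⟩ :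
      ∃ A, (∫ t in (1:ℝ)..s, Hc * t ^ (Hc - 1) * gbar C₀ β t) + c₁ = A := ⟨_, rfl⟩
  have hA : 0 < A := by
    have := hG s hs
    rw [Gfun, hAs] at this
    linarith
  have hW : 0 < Wsub m Hc C₀ β c₁ s := by
    rw [Wsub, hAs]
    positivity
  rw [(hasDerivAt_Wsub m Hc C₀ β c₁ hs0 hA hAs).deriv]
  have hr : 0 < s ^ Hc * gbar C₀ β s / A := div_pos hg hA
  generalize s ^ Hc * gbar C₀ β s / A = r at hr ⊢
  generalize Wsub m Hc C₀ β c₁ s = w at hW ⊢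
  constructor
  · have h : (m : ℝ) / (2 * Hc) * (Hc / (m * s) * (r - 1) * w) / w
        = -(1 / (2 * s)) + r / (2 * s) := by
      field_simp
      ring
    rw [h]
    exact le_add_of_nonneg_right (by positivity)
  · have h : w + 2 * ((m : ℝ) / (2 * Hc)) * (Hc / (m * s) * (r - 1) * w) * s = r * w := by
      field_simp
      ring
    rw [h]
    positivity
end
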